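/- arXiv:1904.10007 — 2 statements merged into one kernel-verified Lean document; each statement's English description precedes it below -/
import Mathlib

section
/- Corollary 2 (dual-containment of improved Hermitian codes): Let q be a prime power, F a finite field with q² elements, and let δ be an integer with 1 ≤ δ ≤ q³. The order bound improved Hermitian code Ẽ(δ) ⊆ F^P contains its Euclidean dual, i.e. Ẽ(δ)^⊥ ⊆ Ẽ(δ), if and only if δ ≤ ⌊(q³ − q² + q)/2⌋ + 1. -/
namespace Herm

/-- the order bound function -/
def sig (q i j : ℕ) : ℕ :=
  if i < q ^ 2 - q then q ^ 3 - (i * q + j * (q + 1)) else (q ^ 2 - i) * (q - j)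

lemma sig_lo (q i j : ℕ) (h : i < q ^ 2 - q) (hj : j < q) :
    (sig q i j : ℤ) = (q : ℤ) ^ 3 - (i * q + j * (q + 1)) := by
  unfold sig
  rw [if_pos h]
  have h1 : i + 1 + q ≤ q ^ 2 := by omega
  have h2 : i * q + j * (q + 1) ≤ q ^ 3 := by nlinarith
  push_cast [Nat.cast_sub h2]
  ring

lemma sig_hi (q i j : ℕ) (h : ¬ i < q ^ 2 - q) (hi : i < q ^ 2) (hj : j < q) :
    (sig q i j : ℤ) = ((q : ℤ) ^ 2 - i) * (q - j) := by
  unfold sig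
  rw [if_neg h]
  push_cast [Nat.cast_sub hi.le, Nat.cast_sub hj.le]
  ring

lemma sig_anti (q i j i' j' : ℕ) (hi : i ≤ i') (hj : j ≤ j') (hi' : i' < q ^ 2) (hj' : j' < q) :
    sig q i' j' ≤ sig q i j := by
  zify
  have hi2 : (i : ℤ) ≤ i' := by exact_mod_cast hi
  have hj2 : (j : ℤ) ≤ j' := by exact_mod_cast hj
  have hi3 : (i' : ℤ) < q ^ 2 := by exact_mod_cast hi'
  have hj3 : (j' : ℤ) < q := by exact_mod_cast hj'
  have hq0 : (0 : ℤ) ≤ q := by positivity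
  by_cases h : i < q ^ 2 - q
  · rw [sig_lo q i j h (by omega)]
    by_cases h' : i' < q ^ 2 - q
    · rw [sig_lo q i' j' h' (by omega)]
      nlinarith
    · rw [sig_hi q i' j' h' hi' (by omega)]
      have a1 : (i : ℤ) + 1 + q ≤ q ^ 2 := by
        have : i + 1 + q ≤ q ^ 2 := by omega
        exact_mod_cast this
      have a2 : (q : ℤ) ^ 2 ≤ i' + q := by
        have : q ^ 2 ≤ i' + q := by omega
        exact_mod_cast this
      have b1 : ((q : ℤ) ^ 2 - i') * (q - j') ≤ (q + 1) * (q - j) := by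
        apply mul_le_mul <;> linarith
      nlinarith
  · have h' : ¬ i' < q ^ 2 - q := by omega
    rw [sig_hi q i j h (by omega) (by omega), sig_hi q i' j' h' hi' (by omega)]
    apply mul_le_mul <;> linarith

lemma sig_max_aux (q i j : ℕ) (hq : 2 ≤ q) (hi : i < q ^ 2) (hj : j < q) (h : i < q ^ 2 - q)
    (δ : ℕ) (hδ : δ ≤ (q ^ 3 - q ^ 2 + q) / 2 + 1) :
    δ ≤ sig q i j ∨ δ ≤ sig q (q ^ 2 - 1 - i) (q - 1 - j) := by
  have hT : 2 * (δ : ℤ) ≤ (q : ℤ) ^ 3 - q ^ 2 + q + 2 := by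
    have h1 : q ^ 2 ≤ q ^ 3 := Nat.pow_le_pow_right (by omega) (by omega)
    have h2 : 2 * δ ≤ q ^ 3 - q ^ 2 + q + 2 := by omega
    zify [h1] at h2
    exact h2
  have c1 : ((q ^ 2 - 1 - i : ℕ) : ℤ) = q ^ 2 - 1 - i := by
    rw [Nat.sub_sub, Nat.cast_sub (by omega)]; push_cast; ring
  have c2 : ((q - 1 - j : ℕ) : ℤ) = q - 1 - j := by
    rw [Nat.sub_sub, Nat.cast_sub (by omega)]; push_cast; ring
  have hqq : (2 : ℤ) ≤ q := by exact_mod_cast hq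
  have hjj : (j : ℤ) + 1 ≤ q := by exact_mod_cast hj
  zify
  rw [sig_lo q i j h hj]
  by_cases h' : q ^ 2 - 1 - i < q ^ 2 - q
  · rw [sig_lo q _ _ h' (by omega), c1, c2]
    by_contra! hc
    obtain ⟨x, y⟩ := hc
    have e : ((q : ℤ) ^ 3 - (i * q + j * (q + 1))) + ((q : ℤ) ^ 3 - ((q ^ 2 - 1 - i) * q + (q - 1 - j) * (q + 1))) = q ^ 3 - q ^ 2 + q + 1 := by ring
    linarith
  · have hi2 : i + 1 ≤ q := by omega
    have hi3 : (i : ℤ) + 1 ≤ q := by exact_mod_cast hi2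
    rcases Nat.lt_or_ge 2 q with h3 | h3
    · left
      have h4 : (3 : ℤ) ≤ q := by exact_mod_cast h3
      have e1 : (i : ℤ) * q + j * (q + 1) ≤ (q - 1) * q + (q - 1) * (q + 1) := by nlinarith
      have e2 : (0 : ℤ) ≤ (q : ℤ) ^ 2 * (q - 3) := by apply mul_nonneg <;> [positivity; linarith]
      nlinarith
    · have : q = 2 := by omega
      subst this
      rw [sig_hi 2 _ _ h' (by omega) (by omega), c1, c2]
      have i01 : i = 0 ∨ i = 1 := by omega
      have j01 : j = 0 ∨ j = 1 := by omega
      rcases i01 with rfl | rfl <;> rcases j01 with rfl | rfl <;> norm_num at hT ⊢ <;> omega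

lemma sig_max (q i j : ℕ) (hq : 2 ≤ q) (hi : i < q ^ 2) (hj : j < q)
    (δ : ℕ) (hδ : δ ≤ (q ^ 3 - q ^ 2 + q) / 2 + 1) :
    δ ≤ sig q i j ∨ δ ≤ sig q (q ^ 2 - 1 - i) (q - 1 - j) := by
  by_cases h : i < q ^ 2 - q
  · exact sig_max_aux q i j hq hi hj h δ hδ
  · have h2 : 2 * q ≤ q ^ 2 := by nlinarith
    have := sig_max_aux q (q ^ 2 - 1 - i) (q - 1 - j) hq (by omega) (by omega) (by omega) δ hδ
    have e1 : q ^ 2 - 1 - (q ^ 2 - 1 - i) = i := by omega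
    have e2 : q - 1 - (q - 1 - j) = j := by omega
    rw [e1, e2] at this
    exact this.symm

lemma sig_witness (q : ℕ) (hq : 2 ≤ q) (δ : ℕ) (hδ : (q ^ 3 - q ^ 2 + q) / 2 + 1 < δ) :
    ∃ i j, i < q ^ 2 ∧ j < q ∧ sig q i j < δ ∧ sig q (q ^ 2 - 1 - i) (q - 1 - j) < δ := by
  have h1 : q ^ 2 ≤ q ^ 3 := Nat.pow_le_pow_right (by omega) (by omega)
  have hT : (q : ℤ) ^ 3 - q ^ 2 + q + 2 < 2 * (δ : ℤ) := by
    have h2 : q ^ 3 - q ^ 2 + q + 2 < 2 * δ := by omega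
    zify [h1] at h2
    exact h2
  rcases Nat.even_or_odd' q with ⟨k, hk | hk⟩
  · rcases Nat.lt_or_ge k 2 with h2 | h2
    · have : k = 1 := by omega
      subst this
      subst hk
      refine ⟨2, 0, by norm_num, by norm_num, ?_, ?_⟩ <;> norm_num [sig] at hδ ⊢ <;> omega
    · have f0 : q ^ 2 = 4 * k ^ 2 := by rw [hk]; ring
      have f1 : 2 * k ≤ k ^ 2 := by nlinarith
      have e1 : q ^ 2 - 1 - 2 * k ^ 2 = 2 * k ^ 2 - 1 := by omega
      have e2 : q - 1 - (k - 1) = k := by omega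
      refine ⟨2 * k ^ 2, k - 1, by omega, by omega, ?_, ?_⟩
      · zify
        rw [sig_lo q _ _ (by omega) (by omega)]
        push_cast [Nat.cast_sub (show 1 ≤ k by omega)]
        subst hk
        push_cast at hT ⊢
        nlinarith
      · rw [e1, e2]
        zify
        rw [sig_lo q _ _ (by omega) (by omega)]
        push_cast [Nat.cast_sub (show 1 ≤ 2 * k ^ 2 by omega)]
        subst hk
        push_cast at hT ⊢
        nlinarith
  · have hk1 : 1 ≤ k := by omega
    have f0 : q ^ 2 = 4 * k ^ 2 + 4 * k + 1 := by rw [hk]; ring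
    have f1 : k ≤ k ^ 2 := by nlinarith
    have e1 : q ^ 2 - 1 - (2 * k ^ 2 + 2 * k) = 2 * k ^ 2 + 2 * k := by omega
    have e2 : q - 1 - k = k := by omega
    refine ⟨2 * k ^ 2 + 2 * k, k, by omega, by omega, ?_⟩
    rw [e1, e2, and_self]
    zify
    rw [sig_lo q _ _ (by omega) (by omega)]
    subst hk
    push_cast at hT ⊢
    nlinarith

section field

variable {F : Type*} [Field F] [Fintype F]

lemma sum_eval_zero (f : Polynomial F) (h : f.natDegree < Fintype.card F - 1) :
    ∑ b : F, f.eval b = 0 := by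
  simp_rw [Polynomial.eval_eq_sum_range]
  rw [Finset.sum_comm]
  apply Finset.sum_eq_zero
  intro e he
  rw [← Finset.mul_sum, FiniteField.sum_pow_lt_card_sub_one, mul_zero]
  have := Finset.mem_range.1 he
  omega

lemma sum_pow_top : ∑ b : F, b ^ (Fintype.card F - 1) = -1 := by
  classical
  have h : ∀ b : F, b ^ (Fintype.card F - 1) = 1 - if b = 0 then 1 else 0 := by
    intro b
    split_ifs with hb
    · subst hb
      rw [zero_pow, sub_self]
      have := Fintype.one_lt_card (α := F)
      omega
    · rw [FiniteField.pow_card_sub_one_eq_one b hb, sub_zero]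
  simp_rw [h]
  rw [Finset.sum_sub_distrib]
  simp

lemma sum_eval_monic (f : Polynomial F) (hf : f.Monic) (h : f.natDegree = Fintype.card F - 1) :
    ∑ b : F, f.eval b = -1 := by
  have hlt := Fintype.one_lt_card (α := F)
  have h2 : ∀ b : F, f.eval b = f.eraseLead.eval b + b ^ (Fintype.card F - 1) := by
    intro b
    conv_lhs => rw [← f.eraseLead_add_monomial_natDegree_leadingCoeff]
    rw [hf.leadingCoeff, h]
    simp
  simp_rw [h2]
  rw [Finset.sum_add_distrib, sum_pow_top, sum_eval_zero, zero_add]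
  have := f.eraseLead_natDegree_le
  omega

variable [DecidableEq F] (q : ℕ) (hq : 2 ≤ q) (hF : Fintype.card F = q ^ 2)
  (hadd : ∀ x y : F, (x + y) ^ q = x ^ q + y ^ q)

/-- fibre sum -/
def fib (a : F) (l : ℕ) : F := ∑ b : F, if b ^ q + b = a ^ (q + 1) then b ^ l else 0

include hq hF hadd in
lemma indic (a b : F) : (if b ^ q + b = a ^ (q + 1) then (1 : F) else 0)
    = 1 - (b ^ q + b - a ^ (q + 1)) ^ (q - 1) := by
  set y := b ^ q + b - a ^ (q + 1) with hy
  have hc : ∀ x : F, x ^ (q * q) = x := by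
    intro x
    have := FiniteField.pow_card x
    rwa [hF, pow_two] at this
  have hsub : ∀ x y : F, (x - y) ^ q = x ^ q - y ^ q := by
    intro x y
    have := hadd (x - y) y
    rw [sub_add_cancel] at this
    rw [this]; ring
  have hyq : y ^ q = y := by
    rw [hy, hsub, hadd, ← pow_mul, hc, ← pow_mul, add_mul, pow_add, hc, one_mul]
    ring
  by_cases h0 : y = 0
  · rw [if_pos (sub_eq_zero.1 h0), h0, zero_pow (by omega), sub_zero]
  · rw [if_neg (fun h => h0 (sub_eq_zero.2 h))]
    have : y ^ (q - 1) * y = 1 * y := by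
      rw [← pow_succ, Nat.sub_add_cancel (by omega), hyq, one_mul]
    rw [mul_right_cancel₀ h0 this, sub_self]

open Polynomial in
lemma monic_g (c : F) (hq : 2 ≤ q) (l : ℕ) : ((X : F[X]) ^ l * (X ^ q + X - C c) ^ (q - 1)).Monic ∧
    ((X : F[X]) ^ l * (X ^ q + X - C c) ^ (q - 1)).natDegree = l + (q - 1) * q := by
  have h1 : (X - C c : F[X]).degree < q := by
    rw [degree_X_sub_C]; exact_mod_cast hq
  have m : (X ^ q + X - C c : F[X]).Monic := by
    rw [add_sub_assoc]; exact monic_X_pow_add h1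
  have d : (X ^ q + X - C c : F[X]).natDegree = q := by
    rw [add_sub_assoc]
    exact natDegree_eq_of_degree_eq_some (by
      rw [degree_add_eq_left_of_degree_lt (by rwa [degree_X_pow]), degree_X_pow])
  refine ⟨(monic_X_pow l).mul (m.pow _), ?_⟩
  rw [(monic_X_pow l).natDegree_mul (m.pow _), m.natDegree_pow, d, natDegree_X_pow]

include hq hF hadd in
lemma fib_eq (a : F) (l : ℕ) : fib q a l = ∑ b : F, b ^ l -
    ∑ b : F, ((Polynomial.X : Polynomial F) ^ l *
      (Polynomial.X ^ q + Polynomial.X - Polynomial.C (a ^ (q + 1))) ^ (q - 1)).eval b := by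
  unfold fib
  rw [← Finset.sum_sub_distrib]
  apply Finset.sum_congr rfl
  intro b _
  have := indic q hq hF hadd a b
  have h2 : (if b ^ q + b = a ^ (q + 1) then b ^ l else 0) =
    b ^ l * (if b ^ q + b = a ^ (q + 1) then (1 : F) else 0) := by simp
  rw [h2, this]
  simp
  ring

include hq hF hadd in
lemma fib_lt (a : F) (l : ℕ) (hl : l < q - 1) : fib q a l = 0 := by
  obtain ⟨k, rfl⟩ : ∃ k, q = k + 2 := ⟨q - 2, by omega⟩
  rw [fib_eq _ hq hF hadd, FiniteField.sum_pow_lt_card_sub_one, sum_eval_zero, sub_zero]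
  · rw [(monic_g (k + 2) _ hq l).2, hF]
    apply Nat.lt_sub_of_add_lt
    simp only [show k + 2 - 1 = k + 1 by omega] at *
    nlinarith
  · rw [hF]
    apply Nat.lt_sub_of_add_lt
    simp only [show k + 2 - 1 = k + 1 by omega] at *
    nlinarith

include hq hF hadd in
lemma fib_top (a : F) : fib q a (q - 1) = 1 := by
  obtain ⟨k, rfl⟩ : ∃ k, q = k + 2 := ⟨q - 2, by omega⟩
  rw [fib_eq _ hq hF hadd, FiniteField.sum_pow_lt_card_sub_one,
    sum_eval_monic _ (monic_g (k + 2) _ hq _).1]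
  · ring
  · rw [(monic_g (k + 2) _ hq _).2, hF]
    simp only [show k + 2 - 1 = k + 1 by omega] at *
    apply Nat.eq_sub_of_add_eq
    ring
  · rw [hF]
    apply Nat.lt_sub_of_add_lt
    simp only [show k + 2 - 1 = k + 1 by omega] at *
    nlinarith

lemma fib_rec (a : F) (l : ℕ) : fib q a (l + q) = a ^ (q + 1) * fib q a l - fib q a (l + 1) := by
  unfold fib
  rw [Finset.mul_sum, ← Finset.sum_sub_distrib]
  apply Finset.sum_congr rfl
  intro b _
  split_ifs with h
  · rw [← h]; ring
  · ring

include hq hF hadd in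
lemma fib_const (a : F) (l : ℕ) (hl : l ≤ 2 * q - 2) : fib q a l = fib q 0 l := by
  rcases Nat.lt_or_ge l q with h | h
  · rcases Nat.lt_or_ge l (q - 1) with h' | h'
    · rw [fib_lt q hq hF hadd _ _ h', fib_lt q hq hF hadd _ _ h']
    · have : l = q - 1 := by omega
      rw [this, fib_top q hq hF hadd, fib_top q hq hF hadd]
  · obtain ⟨m, rfl⟩ : ∃ m, l = m + q := ⟨l - q, by omega⟩
    rw [fib_rec, fib_rec, fib_lt q hq hF hadd _ m (by omega), fib_lt q hq hF hadd _ m (by omega)]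
    rcases Nat.lt_or_ge (m + 1) (q - 1) with h' | h'
    · rw [fib_lt q hq hF hadd _ _ h', fib_lt q hq hF hadd _ _ h']; ring
    · have : m + 1 = q - 1 := by omega
      rw [this, fib_top q hq hF hadd, fib_top q hq hF hadd]; ring

lemma sum_P (m l : ℕ) :
    ∑ x : {x : F × F // x.2 ^ q + x.2 = x.1 ^ (q + 1)}, x.1.1 ^ m * x.1.2 ^ l
      = ∑ a : F, a ^ m * fib q a l := by
  have h1 := Finset.sum_subtype (F := inferInstance) (p := fun x : F × F => x.2 ^ q + x.2 = x.1 ^ (q + 1))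
    (Finset.univ.filter fun x : F × F => x.2 ^ q + x.2 = x.1 ^ (q + 1)) (by simp)
    (fun x => x.1 ^ m * x.2 ^ l)
  rw [← h1, Finset.sum_filter, Fintype.sum_prod_type]
  apply Finset.sum_congr rfl
  intro a _
  unfold fib
  rw [Finset.mul_sum]
  apply Finset.sum_congr rfl
  intro b _
  simp

include hq hF hadd in
lemma sum_P_zero (m l : ℕ) (hl : l ≤ 2 * q - 2) (h : m < q ^ 2 - 1 ∨ l < q - 1) :
    ∑ x : {x : F × F // x.2 ^ q + x.2 = x.1 ^ (q + 1)}, x.1.1 ^ m * x.1.2 ^ l = 0 := by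
  rw [sum_P]
  simp_rw [fun a => fib_const q hq hF hadd a l hl]
  rw [← Finset.sum_mul]
  rcases h with h | h
  · rw [FiniteField.sum_pow_lt_card_sub_one (K := F) m (by rwa [hF]), zero_mul]
  · rw [fib_lt q hq hF hadd _ _ h, mul_zero]

include hq hF hadd in
lemma sum_P_top :
    ∑ x : {x : F × F // x.2 ^ q + x.2 = x.1 ^ (q + 1)}, x.1.1 ^ (q ^ 2 - 1) * x.1.2 ^ (q - 1)
      = (-1 : F) := by
  rw [sum_P]
  simp_rw [fun a => fib_top q hq hF hadd a, mul_one]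
  rw [← hF, sum_pow_top]

include hq hF in
lemma card_P : Fintype.card {x : F × F // x.2 ^ q + x.2 = x.1 ^ (q + 1)} ≤ q ^ 2 * q := by
  rw [← Finset.card_univ, mul_comm, ← hF, ← Finset.card_univ (α := F)]
  apply Finset.card_le_mul_card_image_of_maps_to (f := fun x => x.1.1)
  · simp
  intro a _
  let g : Polynomial F := Polynomial.X ^ q + (Polynomial.X - Polynomial.C (a ^ (q + 1)))
  have h1 : (Polynomial.X - Polynomial.C (a ^ (q + 1)) : Polynomial F).degree < q := by
    rw [Polynomial.degree_X_sub_C]; exact_mod_cast hq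
  have hg : g.Monic := Polynomial.monic_X_pow_add h1
  have d : g.natDegree = q :=
    Polynomial.natDegree_eq_of_degree_eq_some (by
      rw [Polynomial.degree_add_eq_left_of_degree_lt (by rwa [Polynomial.degree_X_pow]),
        Polynomial.degree_X_pow])
  calc _ ≤ g.roots.toFinset.card := by
        apply Finset.card_le_card_of_injOn (fun x => x.1.2)
        · intro x hx
          have hx1 : x.1.1 = a := by simpa using hx
          have := x.2
          rw [hx1] at this
          simp only [Finset.mem_coe, Multiset.mem_toFinset, Polynomial.mem_roots hg.ne_zero,
            Polynomial.IsRoot.def]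
          simp only [g, Polynomial.eval_add, Polynomial.eval_sub, Polynomial.eval_pow,
            Polynomial.eval_X, Polynomial.eval_C]
          rw [← this]; ring
        · intro x hx y hy hxy
          have hx1 : x.1.1 = a := by simpa using hx
          have hy1 : y.1.1 = a := by simpa using hy
          exact Subtype.ext (Prod.ext (hx1.trans hy1.symm) hxy)
    _ ≤ g.roots.card := Multiset.toFinset_card_le _
    _ ≤ q := d ▸ g.card_roots'

end field

lemma add_pow_q {F : Type*} [Field F] [Fintype F] (q : ℕ) (hq : IsPrimePow q)
    (hF : Fintype.card F = q ^ 2) (x y : F) : (x + y) ^ q = x ^ q + y ^ q := by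
  obtain ⟨r, k, hr, hk, rfl⟩ := hq
  have hr' := hr.nat_prime
  haveI : Fact r.Prime := ⟨hr'⟩
  haveI : CharP F r := by
    obtain ⟨p, hc⟩ := CharP.exists F
    obtain ⟨n, hp, hn⟩ := FiniteField.card F p
    have h1 : p ∣ r := by
      have : p ∣ (r ^ k) ^ 2 := by
        rw [← hF, hn]
        exact dvd_pow_self _ n.2.ne'
      exact hp.dvd_of_dvd_pow (hp.dvd_of_dvd_pow this)
    rwa [(Nat.prime_dvd_prime_iff_eq hp hr').1 h1] at hc
  exact add_pow_char_pow x y r k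

section linalg

variable {F I P : Type*} [Field F] [Fintype P] [Fintype I] [PartialOrder I]
  (v : I → P → F) (bar : I → I) (hbb : ∀ s, bar (bar s) = s)
  (hanti : ∀ s t, s ≤ t → bar t ≤ bar s)
  (hz : ∀ s t, ¬ bar s ≤ t → ∑ x, v s x * v t x = 0)
  (hnz : ∀ s, ∑ x, v s x * v (bar s) x ≠ 0)

include hbb hanti hz hnz in
lemma key (S : Set I) (hS : ∀ s t, s ≤ t → t ∈ S → s ∈ S) (c : I → F)
    (h : ∀ t ∈ S, ∑ x, (∑ s, c s • v s) x * v t x = 0) (s : I) (hs : bar s ∈ S) : c s = 0 := by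
  classical
  by_contra hc
  obtain ⟨m, hm⟩ := (Set.toFinite {s | bar s ∈ S ∧ c s ≠ 0}).exists_maximal ⟨s, hs, hc⟩
  obtain ⟨⟨hm1, hm2⟩, hm3⟩ := hm
  have h1 := h _ hm1
  simp only [Finset.sum_apply, Pi.smul_apply, smul_eq_mul, Finset.sum_mul] at h1
  rw [Finset.sum_comm, Finset.sum_eq_single m] at h1
  · simp_rw [mul_assoc] at h1
    rw [← Finset.mul_sum] at h1
    exact (mul_ne_zero hm2 (hnz m)) h1
  · intro t _ ht
    simp_rw [mul_assoc]
    rw [← Finset.mul_sum]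
    by_cases hb : bar t ≤ bar m
    · have hmt : m ≤ t := by
        have := hanti _ _ hb
        rwa [hbb, hbb] at this
      have : c t = 0 := by
        by_contra hct
        exact ht (le_antisymm (hm3 ⟨hS _ _ hb hm1, hct⟩ hmt) hmt)
      rw [this, zero_mul]
    · rw [hz _ _ hb, mul_zero]
  · simp

include hbb hanti hz hnz in
lemma linInd : LinearIndependent F v := by
  rw [Fintype.linearIndependent_iff]
  intro c hc s
  apply key v bar hbb hanti hz hnz Set.univ (by simp) c _ s trivial
  intro t _
  rw [hc]; simp

include hbb hanti hz hnz in
lemma mainLin (hcard : Fintype.card P ≤ Fintype.card I) (S : Set I)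
    (hS : ∀ s t, s ≤ t → t ∈ S → s ∈ S) :
    (∀ u : P → F, (∀ w ∈ Submodule.span F (v '' S), ∑ x, u x * w x = 0) →
      u ∈ Submodule.span F (v '' S)) ↔ ∀ s, s ∈ S ∨ bar s ∈ S := by
  have hli := linInd v bar hbb hanti hz hnz
  constructor
  · intro h s
    by_contra! hs
    refine (hli.notMem_span_image hs.1) (h (v s) ?_)
    intro w hw
    induction hw using Submodule.span_induction with
    | mem w hw =>
      obtain ⟨t, ht, rfl⟩ := hw
      exact hz _ _ (fun hb => hs.2 (hS _ _ hb ht))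
    | zero => simp
    | add a b _ _ ha hb => simp only [Pi.add_apply, mul_add, Finset.sum_add_distrib, ha, hb, add_zero]
    | smul r a _ ha =>
      simp only [Pi.smul_apply, smul_eq_mul, mul_left_comm _ r, ← Finset.mul_sum, ha, mul_zero]
  · intro h u hu
    have hc2 : Fintype.card I = Module.finrank F (P → F) := by
      apply le_antisymm hli.fintype_card_le_finrank
      rwa [Module.finrank_fintype_fun_eq_card]
    have htop := hli.span_eq_top_of_card_eq_finrank' hc2
    have hu2 : u ∈ Submodule.span F (Set.range v) := by rw [htop]; trivial
    obtain ⟨c, rfl⟩ := (Submodule.mem_span_range_iff_exists_fun F).1 hu2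
    apply Submodule.sum_mem
    intro s _
    rcases h s with hs | hs
    · exact Submodule.smul_mem _ _ (Submodule.subset_span ⟨s, hs, rfl⟩)
    · rw [key v bar hbb hanti hz hnz S hS c (fun t ht => hu _ (Submodule.subset_span ⟨t, ht, rfl⟩)) s hs,
        zero_smul]
      exact Submodule.zero_mem _

end linalg

end Herm

/-- Corollary 2: the order bound improved Hermitian code `Ẽ(δ)` contains its
Euclidean dual if and only if `δ ≤ ⌊(q³ - q² + q)/2⌋ + 1`. -/
theorem stmt_13 (q : ℕ) (hq : IsPrimePow q) (F : Type*) [Field F] [Fintype F]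
    [DecidableEq F] (hF : Fintype.card F = q ^ 2) (δ : ℕ) (hδ₁ : 1 ≤ δ)
    (hδ₂ : δ ≤ q ^ 3)
    (E : Submodule F ({x : F × F // x.2 ^ q + x.2 = x.1 ^ (q + 1)} → F))
    (hE : E = Submodule.span F
      {v : {x : F × F // x.2 ^ q + x.2 = x.1 ^ (q + 1)} → F |
        ∃ i j : ℕ, i < q ^ 2 ∧ j < q ∧
          δ ≤ (if i < q ^ 2 - q then q ^ 3 - (i * q + j * (q + 1))
               else (q ^ 2 - i) * (q - j)) ∧
          v = fun x => x.1.1 ^ i * x.1.2 ^ j}) :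
    (∀ u : {x : F × F // x.2 ^ q + x.2 = x.1 ^ (q + 1)} → F,
        (∀ v ∈ E, ∑ x, u x * v x = 0) → u ∈ E)
      ↔ δ ≤ (q ^ 3 - q ^ 2 + q) / 2 + 1 := by
  have hq2 : 2 ≤ q := hq.two_le
  have hadd := Herm.add_pow_q (F := F) q hq hF
  let v : Fin (q ^ 2) × Fin q → {x : F × F // x.2 ^ q + x.2 = x.1 ^ (q + 1)} → F :=
    fun s x => x.1.1 ^ (s.1 : ℕ) * x.1.2 ^ (s.2 : ℕ)
  let bar : Fin (q ^ 2) × Fin q → Fin (q ^ 2) × Fin q := fun s => (s.1.rev, s.2.rev)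
  let S : Set (Fin (q ^ 2) × Fin q) := {s | δ ≤ Herm.sig q s.1 s.2}
  have hES : E = Submodule.span F (v '' S) := by
    rw [hE]
    congr 1
    ext w
    constructor
    · rintro ⟨i, j, hi, hj, h, rfl⟩
      exact ⟨(⟨i, hi⟩, ⟨j, hj⟩), h, rfl⟩
    · rintro ⟨s, hs, rfl⟩
      exact ⟨s.1, s.2, s.1.2, s.2.2, hs, rfl⟩
  have hprod : ∀ s t, ∑ x, v s x * v t x =
      ∑ x : {x : F × F // x.2 ^ q + x.2 = x.1 ^ (q + 1)},
        x.1.1 ^ ((s.1 : ℕ) + t.1) * x.1.2 ^ ((s.2 : ℕ) + t.2) := by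
    intro s t
    apply Finset.sum_congr rfl
    intro x _
    simp only [v, pow_add]
    ring
  have hbar1 : ∀ s, ((bar s).1 : ℕ) = q ^ 2 - 1 - s.1 := by
    intro s; simp only [bar, Fin.val_rev]; omega
  have hbar2 : ∀ s, ((bar s).2 : ℕ) = q - 1 - s.2 := by
    intro s; simp only [bar, Fin.val_rev]; omega
  rw [hES, Herm.mainLin v bar (by intro s; simp [bar]) (by
      intro s t h
      exact ⟨Fin.rev_le_rev.2 h.1, Fin.rev_le_rev.2 h.2⟩) ?_ ?_ ?_ S ?_]
  · constructor
    · intro h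
      by_contra! hlt
      obtain ⟨i, j, hi, hj, h1, h2⟩ := Herm.sig_witness q hq2 δ hlt
      rcases h (⟨i, hi⟩, ⟨j, hj⟩) with h' | h'
      · exact absurd h1 (not_lt.2 h')
      · simp only [S, Set.mem_setOf_eq, hbar1, hbar2] at h'
        exact absurd h2 (not_lt.2 h')
    · intro h s
      simp only [S, Set.mem_setOf_eq, hbar1, hbar2]
      exact Herm.sig_max q s.1 s.2 hq2 s.1.2 s.2.2 δ h
  · intro s t h
    rw [hprod]
    apply Herm.sum_P_zero q hq2 hF hadd
    · have := s.2.2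
      have := t.2.2
      omega
    · by_contra! hc
      apply h
      constructor
      · rw [Fin.le_def, hbar1]; omega
      · rw [Fin.le_def, hbar2]; omega
  · intro s
    have e1 : (s.1 : ℕ) + (bar s).1 = q ^ 2 - 1 := by
      have := s.1.2
      rw [hbar1]; omega
    have e2 : (s.2 : ℕ) + (bar s).2 = q - 1 := by
      have := s.2.2
      rw [hbar2]; omega
    rw [hprod, e1, e2, Herm.sum_P_top q hq2 hF hadd]
    exact neg_ne_zero.2 one_ne_zero
  · rw [Fintype.card_prod, Fintype.card_fin, Fintype.card_fin]
    exact Herm.card_P q hq2 hF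
  · intro s t hst ht
    exact le_trans ht (Herm.sig_anti q _ _ _ _ hst.1 hst.2 t.1.2 t.2.2)
end

section
/- Lemma 1 (improved codes versus one-point codes): Let q be a prime power and F a finite field with q² elements. For every integer δ with q² − q < δ ≤ q³, the order bound improved Hermitian code Ẽ(δ) equals the one-point Hermitian code C(q³ − δ) as subspaces of F^P; moreover, the code C(q³ − (q² − q)) is strictly contained in Ẽ(q² − q). -/
lemma herm_coeff_zero {F : Type*} [Field F] (n : ℕ) (s : Finset F) (hs : n ≤ s.card)
    (c : Fin n → F) (h : ∀ x ∈ s, ∑ i, c i * x ^ (i : ℕ) = 0) : c = 0 := by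
  have hc : Fintype.card (Fin n) ≤ Fintype.card s := by simpa using hs
  obtain ⟨f⟩ := Function.Embedding.nonempty_of_card_le hc
  refine Matrix.eq_zero_of_forall_index_sum_pow_mul_eq_zero (f := fun i => (f i : F))
    (Subtype.val_injective.comp f.injective) (fun j => ?_)
  rw [← h (f j) (f j).2]
  exact Finset.sum_congr rfl (fun i _ => mul_comm _ _)

lemma herm_add_pow (q : ℕ) (hq : IsPrimePow q) (F : Type*) [Field F] [Fintype F]
    (hF : Fintype.card F = q ^ 2) (x y : F) : (x + y) ^ q = x ^ q + y ^ q := by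
  obtain ⟨p, hp⟩ := CharP.exists F
  obtain ⟨n, hpp, hn⟩ := FiniteField.card F p
  obtain ⟨r, k, hr, hk, rfl⟩ := hq
  have hr' := hr.nat_prime
  have : p = r := by
    have h1 : p ∣ (r ^ k) ^ 2 := by
      rw [← hF, hn]; exact dvd_pow_self _ n.pos.ne'
    exact (Nat.prime_dvd_prime_iff_eq hpp hr').1 (hpp.dvd_of_dvd_pow (hpp.dvd_of_dvd_pow h1))
  subst this
  have : Fact p.Prime := ⟨hpp⟩
  exact add_pow_char_pow x y p k

lemma herm_fiber (q : ℕ) (hq : IsPrimePow q) (F : Type*) [Field F] [Fintype F] [DecidableEq F]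
    (hF : Fintype.card F = q ^ 2) (a : F) :
    q ≤ (Finset.univ.filter (fun b : F => b ^ q + b = a ^ (q + 1))).card := by
  have hq2 : 2 ≤ q := hq.two_le
  have hfr : ∀ x : F, (x ^ q) ^ q = x := by
    intro x
    rw [← pow_mul, ← sq, ← hF, FiniteField.pow_card]
  have hfib : ∀ c : F, (Finset.univ.filter (fun b : F => b ^ q + b = c)).card ≤ q := by
    intro c
    by_contra! hlt
    have h := herm_coeff_zero (q+1) _ hlt
      (fun i => if (i : ℕ) = q then 1 else if (i : ℕ) = 1 then 1 else if (i : ℕ) = 0 then -c else 0) ?_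
    · have := congrFun h (Fin.last q)
      simp at this
    · intro x hx
      simp only [Finset.mem_filter, Finset.mem_univ, true_and] at hx
      rw [Fin.sum_univ_eq_sum_range (fun i => (if i = q then 1 else if i = 1 then 1 else if i = 0 then -c else 0) * x ^ i)]
      rw [Finset.sum_range_succ]
      obtain ⟨m, rfl⟩ : ∃ m, q = m + 2 := ⟨q - 2, by omega⟩
      rw [Finset.sum_range_succ', Finset.sum_range_succ', Finset.sum_eq_zero]
      · simp
        linear_combination hx
      · intro i hi
        have := Finset.mem_range.1 hi
        have h1 : i ≠ m := by omega
        simp [h1]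
  set K := Finset.univ.filter (fun c : F => c ^ q = c) with hK
  have hKc : K.card ≤ q := by
    by_contra! hlt
    have h := herm_coeff_zero (q+1) _ hlt
      (fun i => if (i : ℕ) = q then 1 else if (i : ℕ) = 1 then -1 else 0) ?_
    · have := congrFun h (Fin.last q)
      simp at this
    · intro x hx
      simp only [hK, Finset.mem_filter, Finset.mem_univ, true_and] at hx
      rw [Fin.sum_univ_eq_sum_range (fun i => (if i = q then 1 else if i = 1 then -1 else 0) * x ^ i)]
      rw [Finset.sum_range_succ]
      obtain ⟨m, rfl⟩ : ∃ m, q = m + 2 := ⟨q - 2, by omega⟩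
      rw [Finset.sum_range_succ', Finset.sum_range_succ', Finset.sum_eq_zero]
      · simp
        linear_combination hx
      · intro i hi
        have := Finset.mem_range.1 hi
        have h1 : i ≠ m := by omega
        simp [h1]
  have haK : a ^ (q + 1) ∈ K := by
    simp only [hK, Finset.mem_filter, Finset.mem_univ, true_and]
    rw [← pow_mul, mul_comm, pow_mul, pow_succ, hfr, pow_succ, mul_comm]
  have hmaps : ∀ b ∈ (Finset.univ : Finset F), b ^ q + b ∈ K := by
    intro b _
    simp only [hK, Finset.mem_filter, Finset.mem_univ, true_and]
    rw [herm_add_pow q hq F hF, hfr, add_comm]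
  have hsum := Finset.card_eq_sum_card_fiberwise hmaps
  by_contra! hlt
  have h2 := Finset.sum_lt_sum (s := K) (fun c _ => hfib c) ⟨_, haK, hlt⟩
  rw [← hsum, Finset.card_univ, hF, Finset.sum_const, smul_eq_mul] at h2
  nlinarith

lemma herm_indep (q : ℕ) (hq : IsPrimePow q) (F : Type*) [Field F] [Fintype F]
    (hF : Fintype.card F = q ^ 2) :
    LinearIndependent F (fun (k : Fin (q ^ 2) × Fin q) =>
      (fun x => x.1.1 ^ (k.1 : ℕ) * x.1.2 ^ (k.2 : ℕ) :
        {x : F × F // x.2 ^ q + x.2 = x.1 ^ (q + 1)} → F)) := by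
  classical
  rw [Fintype.linearIndependent_iff]
  intro g hg
  have key : ∀ a : F, (fun j : Fin q => ∑ i : Fin (q ^ 2), g (i, j) * a ^ (i : ℕ)) = 0 := by
    intro a
    refine herm_coeff_zero q _ (herm_fiber q hq F hF a) _ ?_
    intro b hb
    simp only [Finset.mem_filter, Finset.mem_univ, true_and] at hb
    have := congrFun hg ⟨(a, b), hb⟩
    simp only [Finset.sum_apply, Pi.smul_apply, smul_eq_mul, Pi.zero_apply,
      Fintype.sum_prod_type_right] at this
    rw [← this]
    refine Finset.sum_congr rfl (fun j _ => ?_)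
    rw [Finset.sum_mul]
    exact Finset.sum_congr rfl (fun i _ => by ring)
  rintro ⟨i, j⟩
  have := herm_coeff_zero (q ^ 2) (Finset.univ : Finset F) (by rw [Finset.card_univ, hF])
    (fun i => g (i, j)) (fun a _ => congrFun (key a) j)
  exact congrFun this i

lemma herm_arith_CE (q δ i j : ℕ) (hq : 2 ≤ q) (hd : q ^ 2 - q ≤ δ) (hd3 : δ ≤ q ^ 3)
    (hj : j < q) (h : i * q + j * (q + 1) ≤ q ^ 3 - δ) :
    i < q ^ 2 ∧ δ ≤ (if i < q ^ 2 - q then q ^ 3 - (i * q + j * (q + 1))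
               else (q ^ 2 - i) * (q - j)) := by
  have hle : q ≤ q ^ 2 := by nlinarith
  obtain ⟨s, hs⟩ : ∃ s, q ^ 2 = s + q := ⟨q ^ 2 - q, by omega⟩
  have h3 : q ^ 3 = s * q + q ^ 2 := by rw [pow_succ, hs]; nlinarith
  have hds : s ≤ δ := by omega
  have h3' : q ^ 3 - δ + δ = q ^ 3 := by omega
  have hi : i ≤ s + 1 := by
    by_contra! hlt
    have : (s + 2) * q ≤ i * q := Nat.mul_le_mul_right _ hlt
    nlinarith [Nat.zero_le (j * (q + 1))]
  have hs' : q ^ 2 - q = s := by omega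
  rw [hs'] at *
  refine ⟨by omega, ?_⟩
  split_ifs with hlt
  · omega
  · have hj0 : j = 0 := by
      by_contra hne
      have h1 : 1 ≤ j := by omega
      have h2 : s * q ≤ i * q := Nat.mul_le_mul_right _ (by omega)
      have h4 : 1 * (q + 1) ≤ j * (q + 1) := Nat.mul_le_mul_right _ h1
      omega
    subst hj0
    obtain rfl | rfl : i = s ∨ i = s + 1 := by omega
    · have : q ^ 2 - i = q := by omega
      rw [this]; simp; nlinarith
    · have : q ^ 2 - (s + 1) = q - 1 := by omega
      rw [this]
      obtain ⟨t, rfl⟩ : ∃ t, q = t + 1 := ⟨q - 1, by omega⟩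
      simp; nlinarith

lemma herm_arith_EC (q δ i j : ℕ) (hq : 2 ≤ q) (hd : q ^ 2 - q < δ) (hd3 : δ ≤ q ^ 3)
    (hi : i < q ^ 2) (hj : j < q)
    (h : δ ≤ (if i < q ^ 2 - q then q ^ 3 - (i * q + j * (q + 1))
               else (q ^ 2 - i) * (q - j))) :
    i * q + j * (q + 1) ≤ q ^ 3 - δ := by
  have hle : q ≤ q ^ 2 := by nlinarith
  obtain ⟨s, hs⟩ : ∃ s, q ^ 2 = s + q := ⟨q ^ 2 - q, by omega⟩
  have h3 : q ^ 3 = s * q + q ^ 2 := by rw [pow_succ, hs]; nlinarith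
  have hs' : q ^ 2 - q = s := by omega
  have hds : s < δ := by omega
  split_ifs at h with hlt
  · omega
  · obtain ⟨a, ha⟩ : ∃ a, a = q ^ 2 - i := ⟨_, rfl⟩
    obtain ⟨b, hb⟩ : ∃ b, b = q - j := ⟨_, rfl⟩
    rw [← ha, ← hb] at h
    have haq : a ≤ q := by omega
    have hbq : b ≤ q := by omega
    have ha' : a = q := by
      by_contra hne
      have h5 : (a + 1) * q ≤ q * q := Nat.mul_le_mul_right _ (by omega)
      have h6 : a * b ≤ a * q := Nat.mul_le_mul_left _ hbq
      nlinarith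
    have hb' : b = q := by
      by_contra hne
      have h5 : q * (b + 1) ≤ q * q := Nat.mul_le_mul_left _ (by omega)
      rw [ha'] at h
      nlinarith
    have hj0 : j = 0 := by omega
    have his : i = s := by omega
    subst hj0 his ha'
    rw [hb'] at h
    have : a * a = a ^ 2 := by ring
    omega


/-- Lemma 1: for `q² - q < δ ≤ q³` the improved code `Ẽ(δ)` equals the
one-point Hermitian code `C(q³ - δ)`, while `C(q³ - (q² - q))` is strictly
contained in `Ẽ(q² - q)`. -/
theorem stmt_14 (q : ℕ) (hq : IsPrimePow q) (F : Type*) [Field F] [Fintype F]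
    (hF : Fintype.card F = q ^ 2)
    (C : ℕ → Submodule F ({x : F × F // x.2 ^ q + x.2 = x.1 ^ (q + 1)} → F))
    (hC : ∀ m : ℕ, C m = Submodule.span F
      {v : {x : F × F // x.2 ^ q + x.2 = x.1 ^ (q + 1)} → F |
        ∃ i j : ℕ, j < q ∧ i * q + j * (q + 1) ≤ m ∧
          v = fun x => x.1.1 ^ i * x.1.2 ^ j})
    (E : ℕ → Submodule F ({x : F × F // x.2 ^ q + x.2 = x.1 ^ (q + 1)} → F))
    (hE : ∀ δ : ℕ, E δ = Submodule.span F
      {v : {x : F × F // x.2 ^ q + x.2 = x.1 ^ (q + 1)} → F |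
        ∃ i j : ℕ, i < q ^ 2 ∧ j < q ∧
          δ ≤ (if i < q ^ 2 - q then q ^ 3 - (i * q + j * (q + 1))
               else (q ^ 2 - i) * (q - j)) ∧
          v = fun x => x.1.1 ^ i * x.1.2 ^ j}) :
    (∀ δ : ℕ, q ^ 2 - q < δ → δ ≤ q ^ 3 → E δ = C (q ^ 3 - δ)) ∧
    C (q ^ 3 - (q ^ 2 - q)) < E (q ^ 2 - q) := by
  have hq2 : 2 ≤ q := hq.two_le
  have hqq : q ≤ q ^ 2 := by nlinarith
  have hqq3 : q ^ 2 ≤ q ^ 3 := Nat.pow_le_pow_right (by omega) (by norm_num)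
  have hCE : ∀ δ : ℕ, q ^ 2 - q ≤ δ → δ ≤ q ^ 3 → C (q ^ 3 - δ) ≤ E δ := by
    intro δ h1 h2
    rw [hC, hE]
    apply Submodule.span_mono
    rintro v ⟨i, j, hj, hij, rfl⟩
    obtain ⟨hi, h⟩ := herm_arith_CE q δ i j hq2 h1 h2 hj hij
    exact ⟨i, j, hi, hj, h, rfl⟩
  refine ⟨fun δ h1 h2 => le_antisymm ?_ (hCE δ h1.le h2), ?_⟩
  · rw [hC, hE]
    apply Submodule.span_mono
    rintro v ⟨i, j, hi, hj, h, rfl⟩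
    exact ⟨i, j, hj, herm_arith_EC q δ i j hq2 h1 h2 hi hj h, rfl⟩
  · refine lt_of_le_not_ge (hCE _ le_rfl (by omega)) (fun hle => ?_)
    have hsub : q ^ 2 - (q ^ 2 - q) = q := by omega
    have hmem : (fun x => x.1.1 ^ (q ^ 2 - q) * x.1.2 ^ 1 :
        {x : F × F // x.2 ^ q + x.2 = x.1 ^ (q + 1)} → F) ∈ E (q ^ 2 - q) := by
      rw [hE]
      apply Submodule.subset_span
      refine ⟨q ^ 2 - q, 1, by omega, by omega, ?_, rfl⟩
      rw [if_neg (lt_irrefl _), hsub, Nat.mul_sub]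
      apply le_of_eq
      rw [sq, mul_one]
    have hmemC := hle hmem
    rw [hC] at hmemC
    have hind := herm_indep q hq F hF
    set s : Set (Fin (q ^ 2) × Fin q) :=
      {k | (k.1 : ℕ) * q + (k.2 : ℕ) * (q + 1) ≤ q ^ 3 - (q ^ 2 - q)} with hsdef
    have hnot := hind.notMem_span_image (s := s)
      (x := (⟨q ^ 2 - q, by omega⟩, ⟨1, by omega⟩)) ?_
    · apply hnot
      refine Submodule.span_mono ?_ hmemC
      rintro v ⟨i, j, hj, hij, rfl⟩
      obtain ⟨hi, -⟩ := herm_arith_CE q _ i j hq2 le_rfl (by omega) hj hij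
      exact ⟨(⟨i, hi⟩, ⟨j, hj⟩), hij, rfl⟩
    · simp only [hsdef, Set.mem_ofPred_eq, not_le]
      have h3 : q ^ 3 = (q ^ 2 - q) * q + q ^ 2 := by
        rw [Nat.sub_mul, ← sq, ← pow_succ]
        simp only [Nat.reduceAdd]
        omega
      omega
end
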